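/- arXiv:1501.06198 — 5 statements merged into one kernel-verified Lean document; each statement's English description precedes it below -/
import Mathlib

section
/- Assume in addition that 0 < λ_1 < ⋯ < λ_n, that for every partition [n] = A ⊔ B into disjoint subsets the n vectors {c_i : i ∈ A} ∪ {d_j(0) : j ∈ B} are linearly independent, and fix signs s_i, s_i′ ∈ {−1, 1} with s_is_i′ = −1 for all i; set a_i = s_i c_i/‖c_i‖ and b_i = s_i′ d_i(0)/‖d_i(0)‖. Then the flat position of the flexible cross-polytope at u = 0 is an embedded triangulation of the equatorial great sphere: (a) ⟨a_i, m⟩ = ⟨b_i, m⟩ = 0 for all i; (b) the union over all partitions [n] = A ⊔ B of the spherical simplices spanned by {a_i : i ∈ A} ∪ {b_j : j ∈ B} equals the equatorial great sphere {x ∈ ℝ^{n+1} : ‖x‖ = 1 and ⟨x, m⟩ = 0}; (c) for all distinct partitions (A, B) ≠ (A′, B′) of [n], the corresponding spherical simplices intersect exactly in the spherical simplex spanned by their common vertices {a_i : i ∈ A ∩ A′} ∪ {b_j : j ∈ B ∩ B′} (the empty set if there are no common vertices). -/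
open scoped RealInnerProductSpace BigOperators

/-- The spherical simplex spanned by a finite family of vectors: the set of unit
vectors that are nonnegative linear combinations of the family. -/
def sphericalSimplex {E : Type*} [NormedAddCommGroup E] [InnerProductSpace ℝ E]
    {ι : Type*} [Fintype ι] (v : ι → E) : Set E :=
  {x | ‖x‖ = 1 ∧ ∃ t : ι → ℝ, (∀ i, 0 ≤ t i) ∧ x = ∑ i, t i • v i}

theorem complementary_of_max_sub_eq {ρ x y : ℝ} (hρ : 0 < ρ) (hfix : max (x - ρ * y) 0 = x) :
    0 ≤ x ∧ 0 ≤ y ∧ x * y = 0 := by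
  rcases max_cases (x - ρ * y) 0 with ⟨h1, h2⟩ | ⟨h1, h2⟩
  · have hy : ρ * y = 0 := by linarith
    obtain rfl : y = 0 := by simpa [hρ.ne'] using hy
    exact ⟨by linarith, le_rfl, mul_zero x⟩
  · obtain rfl : x = 0 := by linarith
    exact ⟨le_rfl, by by_contra! hy; nlinarith, zero_mul y⟩

/-- Solvability of the linear complementarity problem for a coercive operator. -/
theorem exists_complementary_solution {ι : Type*} [Fintype ι]
    (T : EuclideanSpace ℝ ι →L[ℝ] EuclideanSpace ℝ ι) {α : ℝ} (hα : 0 < α)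
    (hT : ∀ z, α * ‖z‖ ^ 2 ≤ ⟪T z, z⟫) (q : EuclideanSpace ℝ ι) :
    ∃ z : EuclideanSpace ℝ ι, ∀ i, 0 ≤ z i ∧ 0 ≤ (T z + q) i ∧ z i * (T z + q) i = 0 := by
  set L : ℝ := ‖T‖ + α with hL
  have hTn : 0 ≤ ‖T‖ := norm_nonneg T
  have hLpos : 0 < L := by positivity
  set ρ : ℝ := α / L ^ 2 with hρ
  have hρpos : 0 < ρ := by positivity
  set κ : ℝ := 1 - α ^ 2 / L ^ 2 with hκ
  have hκ1 : κ < 1 := by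
    have : 0 < α ^ 2 / L ^ 2 := by positivity
    linarith
  let P : EuclideanSpace ℝ ι → EuclideanSpace ℝ ι := fun v => WithLp.toLp 2 fun i => max (v i) 0
  have hP : ∀ v w, ‖P v - P w‖ ≤ ‖v - w‖ := by
    intro v w
    rw [EuclideanSpace.norm_eq, EuclideanSpace.norm_eq]
    refine Real.sqrt_le_sqrt (Finset.sum_le_sum fun i _ => ?_)
    exact pow_le_pow_left₀ (norm_nonneg _) (abs_max_sub_max_le_abs (v i) (w i) 0) 2
  have hcontr : ∀ z : EuclideanSpace ℝ ι, ‖z - ρ • T z‖ ^ 2 ≤ κ * ‖z‖ ^ 2 := by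
    intro z
    have h1 : ‖T z‖ ^ 2 ≤ L ^ 2 * ‖z‖ ^ 2 := by
      rw [← mul_pow]
      refine pow_le_pow_left₀ (norm_nonneg _) ((T.le_opNorm z).trans ?_) 2
      gcongr
      linarith
    have h2 := mul_le_mul_of_nonneg_left h1 (sq_nonneg ρ)
    have h3 := mul_le_mul_of_nonneg_left (hT z) hρpos.le
    have h4 : ρ ^ 2 * (L ^ 2 * ‖z‖ ^ 2) = α ^ 2 / L ^ 2 * ‖z‖ ^ 2 := by
      rw [hρ]; field_simp
    have h5 : ρ * (α * ‖z‖ ^ 2) = α ^ 2 / L ^ 2 * ‖z‖ ^ 2 := by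
      rw [hρ]; ring
    rw [norm_sub_sq_real, inner_smul_right, norm_smul, Real.norm_of_nonneg hρpos.le,
      real_inner_comm, mul_pow, hκ]
    linarith
  let f : EuclideanSpace ℝ ι → EuclideanSpace ℝ ι := fun z => P (z - ρ • (T z + q))
  have hf : ContractingWith (Real.sqrt κ).toNNReal f := by
    refine ⟨?_, LipschitzWith.of_dist_le_mul fun v w => ?_⟩
    · rw [Real.toNNReal_lt_one, Real.sqrt_lt' one_pos]
      simpa using hκ1
    · rw [dist_eq_norm, dist_eq_norm, Real.coe_toNNReal _ (Real.sqrt_nonneg _)]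
      refine (hP _ _).trans ?_
      have he : v - ρ • (T v + q) - (w - ρ • (T w + q)) = (v - w) - ρ • T (v - w) := by
        rw [map_sub]; module
      rw [he]
      refine Real.le_sqrt_of_sq_le (hcontr _) |>.trans_eq ?_
      rw [Real.sqrt_mul' _ (sq_nonneg _), Real.sqrt_sq (norm_nonneg _)]
  obtain ⟨z, hz⟩ : ∃ z, f z = z := ⟨_, hf.fixedPoint_isFixedPt⟩
  refine ⟨z, fun i => complementary_of_max_sub_eq hρpos ?_⟩
  exact congrArg (fun v : EuclideanSpace ℝ ι => v i) hz

theorem sum_subtype_eq_sum_of_zero {M ι : Type*} [AddCommGroup M] [Fintype ι]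
    {P : ι → Prop} [DecidablePred P] (f : ι → M) (hf : ∀ i, ¬P i → f i = 0) :
    ∑ i : {i // P i}, f i = ∑ i, f i := by
  rw [← Fintype.sum_subtype_add_sum_subtype P f, left_eq_add]
  exact Finset.sum_eq_zero fun i _ => hf i i.2

section ComplementaryCones

variable {E : Type*} [NormedAddCommGroup E] [InnerProductSpace ℝ E] {ι : Type*} [Fintype ι]
  [DecidableEq ι] {ν c d : ι → E}

theorem inner_sum_smul_dual (hc : ∀ i j, ⟪c i, ν j⟫ = if i = j then 1 else 0) (t : ι → ℝ)
    (j : ι) : ⟪∑ i, t i • c i, ν j⟫ = t j := by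
  simp [sum_inner, inner_smul_left, hc]

theorem complementary_coeffs_unique (hν : LinearIndependent ℝ ν)
    (hc : ∀ i j, ⟪c i, ν j⟫ = if i = j then 1 else 0)
    (hd : ∀ y : ι → ℝ, ⟪∑ i, y i • d i, ∑ j, y j • ν j⟫ = ‖∑ j, y j • ν j‖ ^ 2)
    {t r t' r' : ι → ℝ} (ht : ∀ i, 0 ≤ t i) (hr : ∀ i, 0 ≤ r i) (ht' : ∀ i, 0 ≤ t' i)
    (hr' : ∀ i, 0 ≤ r' i) (htr : ∀ i, t i * r i = 0) (htr' : ∀ i, t' i * r' i = 0)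
    (he : ∑ i, t i • c i - ∑ i, r i • d i = ∑ i, t' i • c i - ∑ i, r' i • d i) :
    t = t' ∧ r = r' := by
  have hdc : ∑ i, (r i - r' i) • d i = ∑ i, (t i - t' i) • c i := by
    simp only [sub_smul, Finset.sum_sub_distrib]
    rw [sub_eq_sub_iff_add_eq_add] at he ⊢
    rw [add_comm, ← he, add_comm]
  have hle : ‖∑ j, (r j - r' j) • ν j‖ ^ 2 ≤ 0 := by
    rw [← hd fun i => r i - r' i, hdc, inner_sum]
    refine Finset.sum_nonpos fun j _ => ?_
    rw [inner_smul_right, inner_sum_smul_dual hc fun i => t i - t' i]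
    nlinarith [htr j, htr' j, mul_nonneg (ht j) (hr' j), mul_nonneg (ht' j) (hr j)]
  have hzero : ∑ j, (r j - r' j) • ν j = 0 := by
    simpa using le_antisymm hle (sq_nonneg _)
  have hrr : ∀ j, r j - r' j = 0 := Fintype.linearIndependent_iff.1 hν _ hzero
  refine ⟨funext fun j => ?_, funext fun j => sub_eq_zero.1 (hrr j)⟩
  have h1 := inner_sum_smul_dual hc (fun i => t i - t' i) j
  rw [← hdc] at h1
  simp only [hrr, zero_smul, Finset.sum_const_zero, inner_zero_left] at h1
  linarith

theorem exists_complementary_coeffs (hν : LinearIndependent ℝ ν)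
    (hc : ∀ i j, ⟪c i, ν j⟫ = if i = j then 1 else 0)
    (hd : ∀ y : ι → ℝ, ⟪∑ i, y i • d i, ∑ j, y j • ν j⟫ = ‖∑ j, y j • ν j‖ ^ 2)
    (hc_mem : ∀ i, c i ∈ Submodule.span ℝ (Set.range ν))
    (hd_mem : ∀ i, d i ∈ Submodule.span ℝ (Set.range ν))
    {x : E} (hx : x ∈ Submodule.span ℝ (Set.range ν)) :
    ∃ t r : ι → ℝ, (∀ i, 0 ≤ t i) ∧ (∀ i, 0 ≤ r i) ∧ (∀ i, t i * r i = 0) ∧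
      x = ∑ i, t i • c i - ∑ i, r i • d i := by
  let N : EuclideanSpace ℝ ι →ₗ[ℝ] E :=
    Fintype.linearCombination ℝ ν ∘ₗ (WithLp.linearEquiv 2 ℝ (ι → ℝ)).toLinearMap
  have hN : ∀ y, N y = ∑ j, y j • ν j := fun y => rfl
  have hNker : LinearMap.ker N = ⊥ := by
    refine (LinearMap.ker_eq_bot').2 fun y hy => ?_
    ext j
    exact Fintype.linearIndependent_iff.1 hν _ ((hN y).symm.trans hy) j
  obtain ⟨K, hK, hKN⟩ := N.exists_antilipschitzWith hNker
  let T₀ : EuclideanSpace ℝ ι →ₗ[ℝ] EuclideanSpace ℝ ι :=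
    { toFun := fun y => WithLp.toLp 2 fun j => ⟪∑ i, y i • d i, ν j⟫
      map_add' := fun y z => by
        ext j
        simp [add_smul, Finset.sum_add_distrib, inner_add_left]
      map_smul' := fun a y => by
        ext j
        simp [mul_smul, ← Finset.smul_sum, inner_smul_left] }
  have hT₀ : ∀ y j, T₀ y j = ⟪∑ i, y i • d i, ν j⟫ := fun y j => rfl
  have hcoer : ∀ y, ((K : ℝ) ^ 2)⁻¹ * ‖y‖ ^ 2 ≤ ⟪T₀.toContinuousLinearMap y, y⟫ := by
    intro y
    have h1 : ⟪T₀ y, y⟫ = ‖N y‖ ^ 2 := by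
      rw [hN, ← hd, inner_sum, PiLp.inner_apply]
      refine Finset.sum_congr rfl fun j _ => ?_
      rw [hT₀, inner_smul_right]
      simp
    have h2 : ‖y‖ ≤ K * ‖N y‖ := by
      simpa using hKN.le_mul_dist y 0
    have hK' : (0 : ℝ) < K := hK
    rw [LinearMap.coe_toContinuousLinearMap', h1, inv_mul_le_iff₀ (by positivity), ← mul_pow]
    exact pow_le_pow_left₀ (norm_nonneg _) h2 2
  have hK' : (0 : ℝ) < ((K : ℝ) ^ 2)⁻¹ := by
    have : (0 : ℝ) < K := hK
    positivity
  obtain ⟨z, hz⟩ := exists_complementary_solution T₀.toContinuousLinearMap hK' hcoer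
    (WithLp.toLp 2 fun j => ⟪x, ν j⟫)
  have hw : ∀ j, (T₀.toContinuousLinearMap z + WithLp.toLp 2 fun j => ⟪x, ν j⟫) j =
      ⟪∑ i, z i • d i, ν j⟫ + ⟪x, ν j⟫ := fun j => rfl
  simp only [hw] at hz
  refine ⟨fun j => ⟪∑ i, z i • d i, ν j⟫ + ⟪x, ν j⟫, z, fun i => (hz i).2.1, fun i => (hz i).1,
    fun i => by rw [mul_comm]; exact (hz i).2.2, ?_⟩
  set t : ι → ℝ := fun j => ⟪∑ i, z i • d i, ν j⟫ + ⟪x, ν j⟫ with ht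
  set w := x - (∑ i, t i • c i - ∑ i, z i • d i) with hwdef
  have hw_mem : w ∈ Submodule.span ℝ (Set.range ν) :=
    sub_mem hx (sub_mem (sum_mem fun i _ => Submodule.smul_mem _ _ (hc_mem i))
      (sum_mem fun i _ => Submodule.smul_mem _ _ (hd_mem i)))
  have hw_orth : w ∈ (Submodule.span ℝ (Set.range ν))ᗮ := by
    rw [Submodule.mem_orthogonal']
    intro u hu
    induction hu using Submodule.span_induction with
    | mem u hu =>
      obtain ⟨j, rfl⟩ := hu
      rw [hwdef, inner_sub_left, inner_sub_left, inner_sum_smul_dual hc, ht]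
      ring
    | zero => simp
    | add u v _ _ hu hv => rw [inner_add_right, hu, hv, add_zero]
    | smul a u _ hu => rw [inner_smul_right, hu, mul_zero]
  have hw0 : w = 0 := by
    have := Submodule.inner_right_of_mem_orthogonal hw_mem hw_orth
    simpa using this
  exact sub_eq_zero.1 hw0

variable {p q : ι → ℝ}

theorem sum_smul_ite_eq (A : Finset ι) (u : ι → ℝ) :
    ∑ i, u i • (if i ∈ A then p i • c i else -(q i • d i)) =
      ∑ i, (if i ∈ A then u i * p i else 0) • c i -
        ∑ i, (if i ∈ A then 0 else u i * q i) • d i := by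
  rw [← Finset.sum_sub_distrib]
  refine Finset.sum_congr rfl fun i _ => ?_
  split_ifs <;> simp [mul_smul]

theorem iUnion_sphericalSimplex_eq (hν : LinearIndependent ℝ ν)
    (hc : ∀ i j, ⟪c i, ν j⟫ = if i = j then 1 else 0)
    (hd : ∀ y : ι → ℝ, ⟪∑ i, y i • d i, ∑ j, y j • ν j⟫ = ‖∑ j, y j • ν j‖ ^ 2)
    (hc_mem : ∀ i, c i ∈ Submodule.span ℝ (Set.range ν))
    (hd_mem : ∀ i, d i ∈ Submodule.span ℝ (Set.range ν))
    (hp : ∀ i, 0 < p i) (hq : ∀ i, 0 < q i) :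
    (⋃ A : Finset ι, sphericalSimplex fun i => if i ∈ A then p i • c i else -(q i • d i)) =
      {x : E | ‖x‖ = 1 ∧ x ∈ Submodule.span ℝ (Set.range ν)} := by
  ext x
  simp only [Set.mem_iUnion, Set.mem_ofPred_eq]
  constructor
  · rintro ⟨A, hx, u, -, rfl⟩
    refine ⟨hx, sum_mem fun i _ => Submodule.smul_mem _ _ ?_⟩
    dsimp only
    split_ifs
    · exact Submodule.smul_mem _ _ (hc_mem i)
    · exact neg_mem (Submodule.smul_mem _ _ (hd_mem i))
  · rintro ⟨hx, hxs⟩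
    obtain ⟨t, r, ht, hr, htr, hxe⟩ := exists_complementary_coeffs hν hc hd hc_mem hd_mem hxs
    refine ⟨Finset.univ.filter fun i => r i = 0, hx,
      fun i => if r i = 0 then t i / p i else r i / q i, fun i => ?_, ?_⟩
    · dsimp only
      split_ifs
      · exact div_nonneg (ht i) (hp i).le
      · exact div_nonneg (hr i) (hq i).le
    · rw [sum_smul_ite_eq, hxe]
      congr 1 <;> refine Finset.sum_congr rfl fun i _ => ?_
      · by_cases h : r i = 0
        · simp [h, (hp i).ne']
        · have : t i = 0 := by simpa [h] using htr i
          simp [h, this]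
      · by_cases h : r i = 0
        · simp [h]
        · simp [h, (hq i).ne']

theorem sphericalSimplex_inter_eq (hν : LinearIndependent ℝ ν)
    (hc : ∀ i j, ⟪c i, ν j⟫ = if i = j then 1 else 0)
    (hd : ∀ y : ι → ℝ, ⟪∑ i, y i • d i, ∑ j, y j • ν j⟫ = ‖∑ j, y j • ν j‖ ^ 2)
    (hp : ∀ i, 0 < p i) (hq : ∀ i, 0 < q i) (A A' : Finset ι) :
    (sphericalSimplex fun i => if i ∈ A then p i • c i else -(q i • d i)) ∩
        (sphericalSimplex fun i => if i ∈ A' then p i • c i else -(q i • d i)) =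
      sphericalSimplex fun i : {i : ι // (i ∈ A ∧ i ∈ A') ∨ (i ∉ A ∧ i ∉ A')} =>
        if (i : ι) ∈ A then p i • c i else -(q i • d i) := by
  ext x
  constructor
  · rintro ⟨⟨hx, u, hu, hxu⟩, -, u', hu', hxu'⟩
    refine ⟨hx, fun i => u i, fun i => hu i, ?_⟩
    have he := hxu.symm.trans hxu'
    rw [sum_smul_ite_eq, sum_smul_ite_eq] at he
    have hnn : ∀ (B : Finset ι) (v : ι → ℝ), (∀ i, 0 ≤ v i) →
        (∀ i, 0 ≤ if i ∈ B then v i * p i else 0) ∧ (∀ i, 0 ≤ if i ∈ B then 0 else v i * q i) := by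
      intro B v hv
      constructor <;> intro i <;> split_ifs
      exacts [mul_nonneg (hv i) (hp i).le, le_rfl, le_rfl, mul_nonneg (hv i) (hq i).le]
    have hcompl : ∀ (B : Finset ι) (v : ι → ℝ) (i : ι),
        (if i ∈ B then v i * p i else 0) * (if i ∈ B then 0 else v i * q i) = 0 := by
      intro B v i
      split_ifs <;> simp
    obtain ⟨h1, h2⟩ := complementary_coeffs_unique hν hc hd (hnn A u hu).1 (hnn A u hu).2
      (hnn A' u' hu').1 (hnn A' u' hu').2 (hcompl A u) (hcompl A' u') he
    have hzero : ∀ i, ¬((i ∈ A ∧ i ∈ A') ∨ (i ∉ A ∧ i ∉ A')) → u i = 0 := by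
      intro i hi
      have h1i := congrFun h1 i
      have h2i := congrFun h2 i
      by_cases hA : i ∈ A <;> by_cases hA' : i ∈ A' <;>
        simp_all [(hp i).ne', (hq i).ne']
    rw [hxu]
    refine (sum_subtype_eq_sum_of_zero _ fun i hi => ?_).symm
    rw [hzero i hi, zero_smul]
  · rintro ⟨hx, u, hu, hxu⟩
    let w : ι → ℝ := fun i =>
      if hi : (i ∈ A ∧ i ∈ A') ∨ (i ∉ A ∧ i ∉ A') then u ⟨i, hi⟩ else 0
    have hw : ∀ i, 0 ≤ w i := by
      intro i
      dsimp only [w]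
      split_ifs
      exacts [hu _, le_rfl]
    have hw_sub : ∀ i : {i : ι // (i ∈ A ∧ i ∈ A') ∨ (i ∉ A ∧ i ∉ A')}, w i = u i :=
      fun i => dif_pos i.2
    have hw_zero : ∀ i, ¬((i ∈ A ∧ i ∈ A') ∨ (i ∉ A ∧ i ∉ A')) → w i = 0 := fun i hi => dif_neg hi
    refine ⟨⟨hx, w, hw, ?_⟩, hx, w, hw, ?_⟩
    · rw [hxu, ← sum_subtype_eq_sum_of_zero (fun i => w i • if i ∈ A then p i • c i else -(q i • d i))
        fun i hi => by rw [hw_zero i hi, zero_smul]]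
      simp only [hw_sub]
    · rw [hxu, ← sum_subtype_eq_sum_of_zero
        (fun i => w i • if i ∈ A' then p i • c i else -(q i • d i))
        fun i hi => by rw [hw_zero i hi, zero_smul]]
      refine Finset.sum_congr rfl fun i _ => ?_
      rw [hw_sub]
      have : (i : ι) ∈ A ↔ (i : ι) ∈ A' := by
        have := i.2
        tauto
      simp only [this]

end ComplementaryCones

/-- The orthogonal complement of a nonzero vector is spanned by any independent family of
the right size inside it. -/
theorem mem_span_range_iff_inner_eq_zero {n : ℕ} {ν : Fin n → EuclideanSpace ℝ (Fin (n + 1))}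
    (hν : LinearIndependent ℝ ν) {m : EuclideanSpace ℝ (Fin (n + 1))} (hm : m ≠ 0)
    (hmν : ∀ i, ⟪m, ν i⟫ = 0) (x : EuclideanSpace ℝ (Fin (n + 1))) :
    x ∈ Submodule.span ℝ (Set.range ν) ↔ ⟪x, m⟫ = 0 := by
  have : Fact (Module.finrank ℝ (EuclideanSpace ℝ (Fin (n + 1))) = n + 1) := ⟨by simp⟩
  have hle : Submodule.span ℝ (Set.range ν) ≤ (ℝ ∙ m)ᗮ := by
    rw [Submodule.span_le]
    rintro _ ⟨i, rfl⟩
    exact Submodule.mem_orthogonal_singleton_iff_inner_right.2 (hmν i)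
  rw [Submodule.eq_of_le_of_finrank_eq hle, Submodule.mem_orthogonal_singleton_iff_inner_left]
  rw [finrank_span_eq_card hν, Submodule.finrank_orthogonal_span_singleton (n := n) hm,
    Fintype.card_fin]

theorem sum_mul_eq_of_add_transpose {ι : Type*} [Fintype ι] {h g : ι → ι → ℝ}
    (hg : ∀ i j, h i j + h j i = 2 * g i j) (y : ι → ℝ) :
    ∑ i, ∑ j, y i * y j * h i j = ∑ i, ∑ j, y i * y j * g i j := by
  have h1 : ∑ i, ∑ j, y i * y j * h i j = ∑ i, ∑ j, y i * y j * h j i := by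
    rw [Finset.sum_comm]
    refine Finset.sum_congr rfl fun i _ => Finset.sum_congr rfl fun j _ => by ring
  have h2 : ∑ i, ∑ j, y i * y j * h i j + ∑ i, ∑ j, y i * y j * h j i =
      2 * ∑ i, ∑ j, y i * y j * g i j := by
    simp only [← Finset.sum_add_distrib, Finset.mul_sum]
    refine Finset.sum_congr rfl fun i _ => Finset.sum_congr rfl fun j _ => ?_
    rw [← mul_add, hg]
    ring
  linarith

/-- if `sᵢsᵢ' = -1` for all `i`, then the flat position at `u = 0` of a
spherical flexible cross-polytope of the simplest type is an embedded triangulation of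
the equatorial great sphere. -/
theorem flat_position_is_embedded_triangulation (n : ℕ) (hn : 2 ≤ n)
    (nv : Fin n → EuclideanSpace ℝ (Fin (n + 1)))
    (m : EuclideanSpace ℝ (Fin (n + 1)))
    (hnv_indep : LinearIndependent ℝ nv)
    (hnv_unit : ∀ i, ‖nv i‖ = 1)
    (hm_unit : ‖m‖ = 1)
    (hm_orth : ∀ i, ⟪m, nv i⟫ = 0)
    (lam : Fin n → ℝ)
    (hlam_ne : ∀ i, lam i ≠ 0)
    (hlam : ∀ i j : Fin n, i ≠ j → lam i ≠ lam j ∧ lam i ≠ -lam j)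
    (h : Fin n → Fin n → ℝ)
    (hhdiag : ∀ i, h i i = 1)
    (hhoff : ∀ i j : Fin n, i ≠ j →
      h i j = 2 * lam i * (lam i * ⟪nv i, nv j⟫ - lam j) / ((lam i) ^ 2 - (lam j) ^ 2))
    (c : Fin n → EuclideanSpace ℝ (Fin (n + 1)))
    (hc_mem : ∀ i, c i ∈ Submodule.span ℝ (Set.range nv))
    (hc_dual : ∀ i j : Fin n, ⟪c i, nv j⟫ = if i = j then 1 else 0)
    (d : Fin n → ℝ → EuclideanSpace ℝ (Fin (n + 1)))
    (hd : ∀ (i : Fin n) (u : ℝ), d i u = (∑ j, h i j • c j)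
      - ((2 * (lam i) ^ 2 * u ^ 2) / ((lam i) ^ 2 * u ^ 2 + 1)) • nv i
      + ((2 * lam i * u) / ((lam i) ^ 2 * u ^ 2 + 1)) • m)
    (hlam_pos : ∀ i, 0 < lam i)
    (hlam_mono : StrictMono lam)
    (hindep : ∀ A : Finset (Fin n),
      LinearIndependent ℝ (fun i : Fin n => if i ∈ A then c i else d i 0))
    (s s' : Fin n → ℝ)
    (hs : ∀ i, s i = 1 ∨ s i = -1)
    (hs' : ∀ i, s' i = 1 ∨ s' i = -1)
    (hss' : ∀ i, s i * s' i = -1)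
    (a : Fin n → EuclideanSpace ℝ (Fin (n + 1)))
    (ha : ∀ i, a i = s i • (‖c i‖⁻¹ • c i))
    (b : Fin n → EuclideanSpace ℝ (Fin (n + 1)))
    (hb : ∀ i, b i = s' i • (‖d i 0‖⁻¹ • d i 0)) :
    -- (a) all vertices lie in the equatorial great sphere
    (∀ i : Fin n, ⟪a i, m⟫ = 0 ∧ ⟪b i, m⟫ = 0) ∧
    -- (b) the facets cover the equatorial great sphere
    (⋃ A : Finset (Fin n),
      sphericalSimplex (fun i : Fin n => if i ∈ A then a i else b i)) =
      {x : EuclideanSpace ℝ (Fin (n + 1)) | ‖x‖ = 1 ∧ ⟪x, m⟫ = 0} ∧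
    -- (c) distinct facets intersect exactly in their common face
    (∀ A A' : Finset (Fin n), A ≠ A' →
      sphericalSimplex (fun i : Fin n => if i ∈ A then a i else b i) ∩
        sphericalSimplex (fun i : Fin n => if i ∈ A' then a i else b i) =
      sphericalSimplex (fun i : {i : Fin n // (i ∈ A ∧ i ∈ A') ∨ (i ∉ A ∧ i ∉ A')} =>
        if (i : Fin n) ∈ A then a i else b i)) := by
  have hm0 : m ≠ 0 := fun h0 => by simp [h0] at hm_unit
  have hd0 : ∀ i, d i 0 = ∑ j, h i j • c j := fun i => by simp [hd]
  have hdn : ∀ i j, ⟪d i 0, nv j⟫ = h i j := fun i j => by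
    rw [hd0, inner_sum_smul_dual hc_dual]
  have hsymm : ∀ i j, h i j + h j i = 2 * ⟪nv i, nv j⟫ := by
    intro i j
    rcases eq_or_ne i j with rfl | hij
    · rw [hhdiag, real_inner_self_eq_norm_sq, hnv_unit]
      norm_num
    · have h1 : lam i ^ 2 - lam j ^ 2 ≠ 0 := by
        rw [sq_sub_sq]
        exact mul_ne_zero (fun h0 => (hlam i j hij).2 (by linarith))
          (sub_ne_zero.2 (hlam i j hij).1)
      have h2 : lam j ^ 2 - lam i ^ 2 ≠ 0 := fun h0 => h1 (by linarith)
      rw [hhoff i j hij, hhoff j i hij.symm, real_inner_comm (nv i) (nv j), div_add_div _ _ h1 h2,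
        div_eq_iff (mul_ne_zero h1 h2)]
      ring
  have hquad : ∀ y : Fin n → ℝ,
      ⟪∑ i, y i • d i 0, ∑ j, y j • nv j⟫ = ‖∑ j, y j • nv j‖ ^ 2 := by
    intro y
    rw [← real_inner_self_eq_norm_sq]
    simp only [sum_inner, inner_sum, real_inner_smul_left, real_inner_smul_right, hdn]
    simpa only [mul_assoc, mul_left_comm (y _) (y _)] using
      sum_mul_eq_of_add_transpose (fun i j => hsymm j i) y
  have hss : ∀ i, s i * s i = 1 := fun i => by rcases hs i with h1 | h1 <;> norm_num [h1]
  have hs0 : ∀ i, s i ≠ 0 := fun i h0 => by simpa [h0] using hss i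
  have hs'_eq : ∀ i, s' i = -s i := fun i => by
    have := congrArg (s i * ·) (hss' i)
    simp only [← mul_assoc, hss] at this
    linarith
  set ν : Fin n → EuclideanSpace ℝ (Fin (n + 1)) := fun i => s i • nv i with hνdef
  set c' : Fin n → EuclideanSpace ℝ (Fin (n + 1)) := fun i => s i • c i with hc'def
  set d' : Fin n → EuclideanSpace ℝ (Fin (n + 1)) := fun i => s i • d i 0 with hd'def
  have hν : LinearIndependent ℝ ν := hnv_indep.units_smul fun i => Units.mk0 (s i) (hs0 i)
  have hmν : ∀ i, ⟪m, ν i⟫ = 0 := fun i => by rw [hνdef, inner_smul_right, hm_orth, mul_zero]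
  have hspan := mem_span_range_iff_inner_eq_zero hnv_indep hm0 hm_orth
  have hspan' := mem_span_range_iff_inner_eq_zero hν hm0 hmν
  have hcm : ∀ i, ⟪c i, m⟫ = 0 := fun i => (hspan _).1 (hc_mem i)
  have hdm : ∀ i, ⟪d i 0, m⟫ = 0 := fun i => (hspan _).1 <| by
    rw [hd0]
    exact sum_mem fun j _ => Submodule.smul_mem _ _ (hc_mem j)
  have hc'_dual : ∀ i j, ⟪c' i, ν j⟫ = if i = j then 1 else 0 := fun i j => by
    rw [hc'def, hνdef, real_inner_smul_left, real_inner_smul_right, hc_dual]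
    split_ifs with hij
    · rw [hij, mul_one, hss]
    · simp
  have hquad' : ∀ y : Fin n → ℝ, ⟪∑ i, y i • d' i, ∑ j, y j • ν j⟫ = ‖∑ j, y j • ν j‖ ^ 2 := by
    intro y
    simpa only [hνdef, hd'def, smul_smul] using hquad fun i => y i * s i
  have hc'_mem : ∀ i, c' i ∈ Submodule.span ℝ (Set.range ν) := fun i => by
    rw [hspan', hc'def, real_inner_smul_left, hcm, mul_zero]
  have hd'_mem : ∀ i, d' i ∈ Submodule.span ℝ (Set.range ν) := fun i => by
    rw [hspan', hd'def, real_inner_smul_left, hdm, mul_zero]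
  have hp : ∀ i, 0 < ‖c i‖⁻¹ := fun i => inv_pos.2 <| norm_pos_iff.2 fun h0 => by
    simpa [h0] using hc_dual i i
  have hq : ∀ i, 0 < ‖d i 0‖⁻¹ := fun i => inv_pos.2 <| norm_pos_iff.2 fun h0 => by
    simpa [h0, hhdiag] using hdn i i
  obtain rfl : a = fun i => ‖c i‖⁻¹ • c' i := funext fun i => by rw [ha, smul_comm]
  obtain rfl : b = fun i => -(‖d i 0‖⁻¹ • d' i) := funext fun i => by
    rw [hb, hs'_eq, neg_smul, smul_comm]
  refine ⟨fun i => ⟨?_, ?_⟩, ?_, fun A A' _ => ?_⟩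
  · rw [← hspan']
    exact Submodule.smul_mem _ _ (hc'_mem i)
  · rw [← hspan']
    exact neg_mem (Submodule.smul_mem _ _ (hd'_mem i))
  · simpa only [hspan'] using iUnion_sphericalSimplex_eq hν hc'_dual hquad' hc'_mem hd'_mem hp hq
  · exact sphericalSimplex_inter_eq hν hc'_dual hquad' hp hq A A'
end

section
/- Let n ≥ 2 and let e_1, …, e_n be an orthonormal family in a Euclidean space. Let λ_1, …, λ_n be positive real numbers with λ_{j+1} > 2n·λ_j for j = 1, …, n−1. For each i set d_i = e_i − Σ_{j≠i} (2λ_iλ_j/(λ_i² − λ_j²)) e_j. Then Σ_{j≠i} (2λ_iλ_j/(λ_i² − λ_j²))² < 1/(n−1); consequently, the angle between d_i and e_i (i.e. arccos(⟨d_i, e_i⟩/‖d_i‖)) is strictly less than arcsin(1/√n). -/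
open scoped RealInnerProductSpace BigOperators

/-- If `a, b > 0` and `b > 2na`, then `(2ab/(a²-b²))² < 1/(n-1)²`. -/
lemma sq_ratio_lt {n a b : ℝ} (hn : 1 < n) (ha : 0 < a) (h : 2 * n * a < b) :
    (2 * a * b / (a ^ 2 - b ^ 2)) ^ 2 < 1 / (n - 1) ^ 2 := by
  have hab : a < b := by nlinarith
  have hb : 0 < b := ha.trans hab
  have hn' : 0 < n - 1 := by linarith
  have hD : 0 < b ^ 2 - a ^ 2 := by nlinarith
  have key : 2 * a * b * (n - 1) < b ^ 2 - a ^ 2 := by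
    nlinarith [mul_lt_mul_of_pos_right h hb, mul_lt_mul_of_pos_left hab ha, mul_pos ha hb]
  have hlt : 2 * a * b / (b ^ 2 - a ^ 2) < 1 / (n - 1) := by
    rw [div_lt_div_iff₀ hD hn']
    linarith
  rw [← neg_sub (b ^ 2), div_neg, neg_sq, ← one_div_pow]
  exact pow_lt_pow_left₀ hlt (by positivity) two_ne_zero

/-- A finite positive sequence whose consecutive ratios exceed `c ≥ 1` has all its
ratios exceeding `c`. -/
lemma mul_lt_of_consecutive {n : ℕ} {c : ℝ} (hc : 1 ≤ c) (lam : Fin n → ℝ)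
    (hpos : ∀ i, 0 < lam i)
    (hgrow : ∀ i j : Fin n, (j : ℕ) = (i : ℕ) + 1 → c * lam i < lam j)
    {i j : Fin n} (hij : i < j) : c * lam i < lam j := by
  obtain ⟨j, hj⟩ := j
  obtain ⟨i, hi⟩ := i
  replace hij : i + 1 ≤ j := hij
  induction j, hij using Nat.le_induction with
  | base => exact hgrow _ _ rfl
  | succ k hk ih =>
    have hk' : k < n := by omega
    have h := hgrow ⟨k, hk'⟩ ⟨k + 1, hj⟩ rfl
    nlinarith [ih hk', hpos ⟨k, hk'⟩]

section OrthonormalPerturbation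

variable {ι E : Type*} [Fintype ι] [DecidableEq ι] [NormedAddCommGroup E]
  [InnerProductSpace ℝ E] {e : ι → E}

lemma Orthonormal.inner_sum_erase (he : Orthonormal ℝ e) (i : ι) (c : ι → ℝ) :
    ⟪∑ j ∈ Finset.univ.erase i, c j • e j, e i⟫ = 0 := by
  rw [sum_inner]
  refine Finset.sum_eq_zero fun j hj => ?_
  rw [real_inner_smul_left, he.inner_eq_zero (Finset.ne_of_mem_erase hj), mul_zero]

lemma Orthonormal.inner_sub_sum_erase (he : Orthonormal ℝ e) (i : ι) (c : ι → ℝ) :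
    ⟪e i - ∑ j ∈ Finset.univ.erase i, c j • e j, e i⟫ = 1 := by
  rw [inner_sub_left, he.inner_sum_erase, real_inner_self_eq_norm_sq, he.1 i]
  norm_num

lemma Orthonormal.norm_sub_sum_erase_sq (he : Orthonormal ℝ e) (i : ι) (c : ι → ℝ) :
    ‖e i - ∑ j ∈ Finset.univ.erase i, c j • e j‖ ^ 2 =
      1 + ∑ j ∈ Finset.univ.erase i, c j ^ 2 := by
  rw [norm_sub_sq_real, real_inner_comm, he.inner_sum_erase, he.1 i,
    ← real_inner_self_eq_norm_sq (∑ j ∈ _, _), he.inner_sum]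
  simp [sq]

end OrthonormalPerturbation

/-- If `N² = 1 + S` with `0 ≤ S < 1/(n-1)`, then `arccos (1/N) < arcsin (1/√n)`. -/
lemma arccos_one_div_lt_arcsin {n N S : ℝ} (hn : 1 < n) (hN : 0 ≤ N) (hS : 0 ≤ S)
    (hNS : N ^ 2 = 1 + S) (hlt : S < 1 / (n - 1)) :
    Real.arccos (1 / N) < Real.arcsin (1 / Real.sqrt n) := by
  have hN1 : 1 ≤ N := by nlinarith
  have hx : 0 < 1 / N := by positivity
  have hn0 : 0 < n := by linarith
  rw [Real.arcsin_eq_arccos (by positivity)]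
  refine Real.arccos_lt_arccos (by linarith [Real.sqrt_nonneg (1 - (1 / √n) ^ 2)]) ?_
    ((div_le_one (by linarith)).2 hN1)
  rw [Real.sqrt_lt' hx, one_div_pow, one_div_pow, Real.sq_sqrt hn0.le, hNS,
    one_sub_div hn0.ne', div_lt_div_iff₀ hn0 (by linarith)]
  rw [lt_div_iff₀ (by linarith)] at hlt
  linarith

/-- the quantitative estimate underlying the embedded spherical flexible
cross-polytope with identity Gram matrix: if `λ_{j+1} > 2n·λ_j` then
`Σ_{j≠i} (2λᵢλⱼ/(λᵢ²-λⱼ²))² < 1/(n-1)`, and consequently the angle between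
`dᵢ = eᵢ - Σ_{j≠i} (2λᵢλⱼ/(λᵢ²-λⱼ²)) eⱼ` and `eᵢ` is less than `arcsin(1/√n)`. -/
theorem vertex_estimate (n : ℕ) (hn : 2 ≤ n)
    {E : Type*} [NormedAddCommGroup E] [InnerProductSpace ℝ E]
    (e : Fin n → E) (he : Orthonormal ℝ e)
    (lam : Fin n → ℝ) (hlam_pos : ∀ i, 0 < lam i)
    (hgrow : ∀ i j : Fin n, (j : ℕ) = (i : ℕ) + 1 → 2 * (n : ℝ) * lam i < lam j)
    (d : Fin n → E)
    (hd : ∀ i, d i = e i -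
      ∑ j ∈ Finset.univ.erase i, (2 * lam i * lam j / ((lam i) ^ 2 - (lam j) ^ 2)) • e j) :
    ∀ i : Fin n,
      (∑ j ∈ Finset.univ.erase i,
        (2 * lam i * lam j / ((lam i) ^ 2 - (lam j) ^ 2)) ^ 2 < 1 / ((n : ℝ) - 1)) ∧
      Real.arccos (⟪d i, e i⟫ / ‖d i‖) < Real.arcsin (1 / Real.sqrt n) := by
  intro i
  have hn2 : (2 : ℝ) ≤ n := by exact_mod_cast hn
  have hn1 : (1 : ℝ) < n := by linarith
  have hratio {i j : Fin n} (hij : i < j) : 2 * (n : ℝ) * lam i < lam j :=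
    mul_lt_of_consecutive (by linarith) lam hlam_pos hgrow hij
  have hterm : ∀ j ∈ Finset.univ.erase i,
      (2 * lam i * lam j / ((lam i) ^ 2 - (lam j) ^ 2)) ^ 2 < 1 / ((n : ℝ) - 1) ^ 2 := by
    intro j hj
    rcases lt_or_gt_of_ne (Finset.ne_of_mem_erase hj) with hji | hij
    · rw [← neg_sub (lam j ^ 2), div_neg, neg_sq, mul_right_comm]
      exact sq_ratio_lt hn1 (hlam_pos j) (hratio hji)
    · exact sq_ratio_lt hn1 (hlam_pos i) (hratio hij)
  have hcard : ((Finset.univ.erase i).card : ℝ) = n - 1 := by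
    rw [Finset.card_erase_of_mem (Finset.mem_univ i), Finset.card_fin,
      Nat.cast_sub (by omega), Nat.cast_one]
  have hne : (Finset.univ.erase i).Nonempty := by
    rw [← Finset.card_pos, ← Nat.cast_pos (α := ℝ), hcard]
    linarith
  have hsum : ∑ j ∈ Finset.univ.erase i,
      (2 * lam i * lam j / ((lam i) ^ 2 - (lam j) ^ 2)) ^ 2 < 1 / ((n : ℝ) - 1) := by
    refine (Finset.sum_lt_sum_of_nonempty hne hterm).trans_eq ?_
    have : (n : ℝ) - 1 ≠ 0 := by linarith
    rw [Finset.sum_const, nsmul_eq_mul, hcard]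
    field_simp
  refine ⟨hsum, ?_⟩
  rw [hd i, he.inner_sub_sum_erase]
  exact arccos_one_div_lt_arcsin hn1 (norm_nonneg _)
    (Finset.sum_nonneg fun _ _ => sq_nonneg _) (he.norm_sub_sum_erase_sq i _) hsum
end

section
/- Set λ̃_i = 1/λ_i for each i, define h̃_{ij} = 2λ̃_i(λ̃_ig_{ij} − λ̃_j)/(λ̃_i² − λ̃_j²) for i ≠ j and h̃_{ii} = 1, and for u ∈ ℝ define d̃_i(u) = Σ_{j=1}^n h̃_{ij}c_j − (2λ̃_i²u²/(λ̃_i²u²+1))n_i + (2λ̃_iu/(λ̃_i²u²+1))m. Then for every u ≠ 0 and every i: d̃_i(1/u) = −d_i(u) + 2⟨d_i(u), m⟩m; that is, d̃_i(1/u) is the negative of the reflection of d_i(u) in the hyperplane orthogonal to m. (This identity underlies the symmetry that interchanges the two flat positions P_0 and P_∞ of a flexible cross-polytope of the simplest type.) -/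
open scoped RealInnerProductSpace BigOperators

/-- A vector orthogonal to every member of a family is orthogonal to its span. -/
theorem mem_orthogonal_span_range {E ι : Type*} [NormedAddCommGroup E] [InnerProductSpace ℝ E]
    {v : ι → E} {x : E} (hx : ∀ i, ⟪x, v i⟫ = 0) :
    x ∈ (Submodule.span ℝ (Set.range v))ᗮ := by
  rw [Submodule.mem_orthogonal']
  intro y hy
  induction hy using Submodule.span_induction with
  | mem y hy =>
    obtain ⟨k, rfl⟩ := hy
    exact hx k
  | zero => simp
  | add y z _ _ hy hz => rw [inner_add_right, hy, hz, add_zero]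
  | smul a y _ hy => rw [real_inner_smul_right, hy, mul_zero]

/-- A vector of the span of a family expands in a dual family lying in that span. -/
theorem sum_inner_smul_dual_eq {E ι : Type*} [NormedAddCommGroup E] [InnerProductSpace ℝ E]
    [Fintype ι] [DecidableEq ι] {v c : ι → E}
    (hc_mem : ∀ i, c i ∈ Submodule.span ℝ (Set.range v))
    (hc_dual : ∀ i j, ⟪c i, v j⟫ = if i = j then 1 else 0)
    {x : E} (hx : x ∈ Submodule.span ℝ (Set.range v)) :
    ∑ j, ⟪x, v j⟫ • c j = x := by
  have hw : ∑ j, ⟪x, v j⟫ • c j - x ∈ Submodule.span ℝ (Set.range v) :=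
    Submodule.sub_mem _ (Submodule.sum_mem _ fun j _ => Submodule.smul_mem _ _ (hc_mem j)) hx
  have horth : ∑ j, ⟪x, v j⟫ • c j - x ∈ (Submodule.span ℝ (Set.range v))ᗮ :=
    mem_orthogonal_span_range fun k => by
      simp [inner_sub_left, sum_inner, real_inner_smul_left, hc_dual]
  exact sub_eq_zero.mp (inner_self_eq_zero.mp (Submodule.inner_right_of_mem_orthogonal hw horth))

/-- The off-diagonal coefficients for the parameters `a, b` and `a⁻¹, b⁻¹` add up to `2 * g`. -/
theorem coeff_add_coeff_inv {a b : ℝ} (g : ℝ) (ha : a ≠ 0) (hb : b ≠ 0)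
    (hab : a ≠ b) (hab' : a ≠ -b) :
    2 * a * (a * g - b) / (a ^ 2 - b ^ 2)
      + 2 * a⁻¹ * (a⁻¹ * g - b⁻¹) / (a⁻¹ ^ 2 - b⁻¹ ^ 2) = 2 * g := by
  have h1 : a ^ 2 - b ^ 2 ≠ 0 := by
    rw [sq_sub_sq]
    exact mul_ne_zero (fun h => hab' (eq_neg_of_add_eq_zero_left h)) (sub_ne_zero.mpr hab)
  have h2 : a⁻¹ ^ 2 - b⁻¹ ^ 2 = -(a ^ 2 - b ^ 2) / (a ^ 2 * b ^ 2) := by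
    field_simp
    ring
  rw [h2]
  field_simp
  ring

/-- with `λ̃ᵢ = 1/λᵢ`, the vector `d̃ᵢ(1/u)` is the negative of the
reflection of `dᵢ(u)` in the hyperplane orthogonal to `m`. This identity interchanges
the two flat positions of a flexible cross-polytope of the simplest type. -/
theorem d_inverse_parameter_symmetry (n : ℕ) (hn : 2 ≤ n)
    (nv : Fin n → EuclideanSpace ℝ (Fin (n + 1)))
    (m : EuclideanSpace ℝ (Fin (n + 1)))
    (hnv_indep : LinearIndependent ℝ nv)
    (hnv_unit : ∀ i, ‖nv i‖ = 1)
    (hm_unit : ‖m‖ = 1)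
    (hm_orth : ∀ i, ⟪m, nv i⟫ = 0)
    (lam : Fin n → ℝ)
    (hlam_ne : ∀ i, lam i ≠ 0)
    (hlam : ∀ i j : Fin n, i ≠ j → lam i ≠ lam j ∧ lam i ≠ -lam j)
    (h : Fin n → Fin n → ℝ)
    (hhdiag : ∀ i, h i i = 1)
    (hhoff : ∀ i j : Fin n, i ≠ j →
      h i j = 2 * lam i * (lam i * ⟪nv i, nv j⟫ - lam j) / ((lam i) ^ 2 - (lam j) ^ 2))
    (c : Fin n → EuclideanSpace ℝ (Fin (n + 1)))
    (hc_mem : ∀ i, c i ∈ Submodule.span ℝ (Set.range nv))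
    (hc_dual : ∀ i j : Fin n, ⟪c i, nv j⟫ = if i = j then 1 else 0)
    (d : Fin n → ℝ → EuclideanSpace ℝ (Fin (n + 1)))
    (hd : ∀ (i : Fin n) (u : ℝ), d i u = (∑ j, h i j • c j)
      - ((2 * (lam i) ^ 2 * u ^ 2) / ((lam i) ^ 2 * u ^ 2 + 1)) • nv i
      + ((2 * lam i * u) / ((lam i) ^ 2 * u ^ 2 + 1)) • m)
    (lamt : Fin n → ℝ)
    (hlamt : ∀ i, lamt i = (lam i)⁻¹)
    (ht : Fin n → Fin n → ℝ)
    (htdiag : ∀ i, ht i i = 1)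
    (htoff : ∀ i j : Fin n, i ≠ j →
      ht i j = 2 * lamt i * (lamt i * ⟪nv i, nv j⟫ - lamt j) / ((lamt i) ^ 2 - (lamt j) ^ 2))
    (dt : Fin n → ℝ → EuclideanSpace ℝ (Fin (n + 1)))
    (hdt : ∀ (i : Fin n) (u : ℝ), dt i u = (∑ j, ht i j • c j)
      - ((2 * (lamt i) ^ 2 * u ^ 2) / ((lamt i) ^ 2 * u ^ 2 + 1)) • nv i
      + ((2 * lamt i * u) / ((lamt i) ^ 2 * u ^ 2 + 1)) • m) :
    ∀ u : ℝ, u ≠ 0 → ∀ i : Fin n,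
      dt i (1 / u) = -(d i u) + (2 * ⟪d i u, m⟫) • m := by
  intro u hu i
  have hL := hlam_ne i
  have hsum : ∑ j, ht i j • c j = (2 : ℝ) • nv i - ∑ j, h i j • c j := by
    rw [eq_sub_iff_add_eq, ← Finset.sum_add_distrib]
    conv_rhs => rw [← sum_inner_smul_dual_eq hc_mem hc_dual
      (Submodule.subset_span (Set.mem_range_self i)), Finset.smul_sum]
    refine Finset.sum_congr rfl fun j _ => ?_
    rw [← add_smul, smul_smul]
    congr 1
    by_cases hij : i = j
    · subst hij
      rw [htdiag, hhdiag, real_inner_self_eq_norm_sq, hnv_unit]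
      norm_num
    · rw [htoff i j hij, hhoff i j hij, hlamt, hlamt, add_comm]
      exact coeff_add_coeff_inv _ hL (hlam_ne j) (hlam i j hij).1 (hlam i j hij).2
  have hcm : ∀ j, ⟪c j, m⟫ = 0 := fun j =>
    Submodule.inner_right_of_mem_orthogonal (hc_mem j) (mem_orthogonal_span_range hm_orth)
  have hnm : ⟪nv i, m⟫ = 0 := by rw [real_inner_comm, hm_orth]
  have hdm : ⟪d i u, m⟫ = (2 * lam i * u) / ((lam i) ^ 2 * u ^ 2 + 1) := by
    rw [hd]
    simp [inner_add_left, inner_sub_left, sum_inner, real_inner_smul_left, hcm,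
      hnm, hm_unit]
  have hD : (lam i) ^ 2 * u ^ 2 + 1 ≠ 0 := by positivity
  have hD' : (lam i)⁻¹ ^ 2 * (1 / u) ^ 2 + 1
      = ((lam i) ^ 2 * u ^ 2 + 1) / ((lam i) ^ 2 * u ^ 2) := by
    field_simp
    ring
  have hn_coeff : (2 * (lamt i) ^ 2 * (1 / u) ^ 2) / ((lamt i) ^ 2 * (1 / u) ^ 2 + 1)
      = 2 - (2 * (lam i) ^ 2 * u ^ 2) / ((lam i) ^ 2 * u ^ 2 + 1) := by
    rw [hlamt, hD']
    field_simp
    ring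
  have hm_coeff : (2 * lamt i * (1 / u)) / ((lamt i) ^ 2 * (1 / u) ^ 2 + 1)
      = (2 * lam i * u) / ((lam i) ^ 2 * u ^ 2 + 1) := by
    rw [hlamt, hD']
    field_simp
  rw [hdm, hdt, hd, hsum, hn_coeff, hm_coeff]
  module
end

section
/- For 1 ≤ k ≤ n and u ∈ ℝ define ν_k(u) = (2λ_ku/(λ_k²u²+1))·n_k + ((λ_k²u²−1)/(λ_k²u²+1))·m. Then ν_k(u) is a unit vector which is orthogonal to c_j for every j ≠ k and orthogonal to d_k(u); moreover ⟨m, ν_k(u)⟩ = (λ_k²u²−1)/(λ_k²u²+1) and ⟨n_k, ν_k(u)⟩ = 2λ_ku/(λ_k²u²+1), so that for λ_k > 0 and u ≥ 0 the angle between m and ν_k(u) equals π − 2·arctan(λ_ku). (Since ±m and ±ν_k(u) are unit normals to the hyperplanes spanned by the two facets adjacent to the (n−2)-dimensional face spanned by {c_j : j ≠ k}, this computes the dihedral angles of the flexible cross-polytope of the simplest type adjacent to the facet [a_1 … a_n]: the tangent of half such a dihedral angle is ±(λ_ku)^{±1}.) -/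
open scoped RealInnerProductSpace BigOperators

theorem angle_eq_pi_sub_two_arctan {E : Type*} [NormedAddCommGroup E] [InnerProductSpace ℝ E]
    {x y : E} {t : ℝ} (hx : ‖x‖ = 1) (hy : ‖y‖ = 1) (ht : 0 ≤ t)
    (hxy : ⟪x, y⟫ = (t ^ 2 - 1) / (t ^ 2 + 1)) :
    InnerProductGeometry.angle x y = Real.pi - 2 * Real.arctan t := by
  have hcos : Real.cos (Real.pi - 2 * Real.arctan t) = (t ^ 2 - 1) / (t ^ 2 + 1) := by
    rw [Real.cos_pi_sub, Real.cos_two_mul, Real.cos_sq_arctan]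
    have : 1 + t ^ 2 ≠ 0 := by positivity
    have : t ^ 2 + 1 ≠ 0 := by positivity
    field_simp
    ring
  have hlt := Real.arctan_lt_pi_div_two t
  have hnonneg := Real.arctan_nonneg.mpr ht
  rw [InnerProductGeometry.angle, hx, hy, hxy, mul_one, div_one, ← hcos,
    Real.arccos_cos (by linarith) (by linarith)]

/-- the vector `ν k u` is a unit normal to the hyperplane of the facet
containing the vertices `c j / ‖c j‖`, `j ≠ k`, and `d k u / ‖d k u‖`; the angle between
`m` and `ν k u` equals `π - 2 arctan(λ_k u)` for `λ_k > 0`, `u ≥ 0`, which computes the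
dihedral angles of the flexible cross-polytope adjacent to the facet `[a_1 … a_n]`. -/
theorem dihedral_angle_normal_vector (n : ℕ) (hn : 2 ≤ n)
    (nv : Fin n → EuclideanSpace ℝ (Fin (n + 1)))
    (m : EuclideanSpace ℝ (Fin (n + 1)))
    (hnv_indep : LinearIndependent ℝ nv)
    (hnv_unit : ∀ i, ‖nv i‖ = 1)
    (hm_unit : ‖m‖ = 1)
    (hm_orth : ∀ i, ⟪m, nv i⟫ = 0)
    (lam : Fin n → ℝ)
    (hlam_ne : ∀ i, lam i ≠ 0)
    (hlam : ∀ i j : Fin n, i ≠ j → lam i ≠ lam j ∧ lam i ≠ -lam j)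
    (h : Fin n → Fin n → ℝ)
    (hhdiag : ∀ i, h i i = 1)
    (hhoff : ∀ i j : Fin n, i ≠ j →
      h i j = 2 * lam i * (lam i * ⟪nv i, nv j⟫ - lam j) / ((lam i) ^ 2 - (lam j) ^ 2))
    (c : Fin n → EuclideanSpace ℝ (Fin (n + 1)))
    (hc_mem : ∀ i, c i ∈ Submodule.span ℝ (Set.range nv))
    (hc_dual : ∀ i j : Fin n, ⟪c i, nv j⟫ = if i = j then 1 else 0)
    (d : Fin n → ℝ → EuclideanSpace ℝ (Fin (n + 1)))
    (hd : ∀ (i : Fin n) (u : ℝ), d i u = (∑ j, h i j • c j)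
      - ((2 * (lam i) ^ 2 * u ^ 2) / ((lam i) ^ 2 * u ^ 2 + 1)) • nv i
      + ((2 * lam i * u) / ((lam i) ^ 2 * u ^ 2 + 1)) • m)
    (ν : Fin n → ℝ → EuclideanSpace ℝ (Fin (n + 1)))
    (hν : ∀ (k : Fin n) (u : ℝ), ν k u =
      ((2 * lam k * u) / ((lam k) ^ 2 * u ^ 2 + 1)) • nv k
      + (((lam k) ^ 2 * u ^ 2 - 1) / ((lam k) ^ 2 * u ^ 2 + 1)) • m) :
    ∀ (k : Fin n) (u : ℝ),
      ‖ν k u‖ = 1 ∧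
      (∀ j : Fin n, j ≠ k → ⟪c j, ν k u⟫ = 0) ∧
      ⟪d k u, ν k u⟫ = 0 ∧
      ⟪m, ν k u⟫ = ((lam k) ^ 2 * u ^ 2 - 1) / ((lam k) ^ 2 * u ^ 2 + 1) ∧
      ⟪nv k, ν k u⟫ = 2 * lam k * u / ((lam k) ^ 2 * u ^ 2 + 1) ∧
      (0 < lam k → 0 ≤ u →
        InnerProductGeometry.angle m (ν k u) = Real.pi - 2 * Real.arctan (lam k * u)) := by
  intro k u
  have hq : lam k ^ 2 * u ^ 2 + 1 ≠ 0 := by positivity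
  have hmm : ⟪m, m⟫ = 1 := by rw [real_inner_self_eq_norm_sq, hm_unit, one_pow]
  have hnn : ⟪nv k, nv k⟫ = 1 := by rw [real_inner_self_eq_norm_sq, hnv_unit, one_pow]
  have hnm : ⟪nv k, m⟫ = 0 := by rw [real_inner_comm, hm_orth]
  have hcm (j : Fin n) : ⟪c j, m⟫ = 0 := by
    refine Submodule.span_induction (p := fun x _ => ⟪x, m⟫ = 0) ?_ (inner_zero_left m)
      (fun x y _ _ hx hy => ?_) (fun a x _ hx => ?_) (hc_mem j)
    · rintro _ ⟨i, rfl⟩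
      rw [real_inner_comm, hm_orth]
    · rw [inner_add_left, hx, hy, add_zero]
    · rw [real_inner_smul_left, hx, mul_zero]
  have hmν : ⟪m, ν k u⟫ = (lam k ^ 2 * u ^ 2 - 1) / (lam k ^ 2 * u ^ 2 + 1) := by
    simp only [hν, inner_add_right, real_inner_smul_right, hm_orth, hmm, mul_zero, mul_one,
      zero_add]
  have hnν : ⟪nv k, ν k u⟫ = 2 * lam k * u / (lam k ^ 2 * u ^ 2 + 1) := by
    simp only [hν, inner_add_right, real_inner_smul_right, hnn, hnm, mul_zero, mul_one, add_zero]
  have hνν : ‖ν k u‖ = 1 := by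
    have hsq : ⟪ν k u, ν k u⟫ = 1 := by
      nth_rewrite 1 [hν]
      rw [inner_add_left, real_inner_smul_left, real_inner_smul_left, hmν, hnν]
      field_simp
      ring
    rw [norm_eq_sqrt_real_inner, hsq, Real.sqrt_one]
  have hcν (j : Fin n) :
      ⟪c j, ν k u⟫ = if j = k then 2 * lam k * u / (lam k ^ 2 * u ^ 2 + 1) else 0 := by
    simp only [hν, inner_add_right, real_inner_smul_right, hcm, hc_dual, mul_zero, add_zero,
      mul_ite, mul_one]
  refine ⟨hνν, fun j hj => by rw [hcν, if_neg hj], ?_, hmν, hnν, fun hl hu => ?_⟩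
  · rw [hd, inner_add_left, inner_sub_left, sum_inner]
    simp only [real_inner_smul_left, hcν, hmν, hnν, mul_ite, mul_zero, Finset.sum_ite_eq',
      Finset.mem_univ, if_true, hhdiag]
    field_simp
    ring
  · exact angle_eq_pi_sub_two_arctan hm_unit hνν (by positivity) (by rw [hmν, mul_pow])
end

section
/- Assume in addition that n ≥ 3, that 0 < λ_1 < ⋯ < λ_n, and that for every partition [n] = A ⊔ B into disjoint subsets the n points {p_i : i ∈ A} ∪ {q_j(0) : j ∈ B} are affinely independent. Consider the flat position u = 0: all the points p_i and q_j(0) lie in the hyperplane Π = {x ∈ ℝ^n : ⟨x, m⟩ = c}. Then at least one of the following two alternatives holds: (i) there exist a point O with ⟨O, m⟩ = c and real numbers r_1, …, r_n ≥ 0 such that for every k ∈ [n] and every pair of disjoint sets I, J with I ⊔ J = [n]∖{k}, the Euclidean distance from O to the affine span of {p_i : i ∈ I} ∪ {q_j(0) : j ∈ J} equals r_k (the (n−1)-dimensional cross-polytopes P_(1), …, P_(n), obtained from the flat cross-polytope by deleting the pairs of opposite vertices, are circumscribed about concentric spheres); or (ii) there exist a unit vector e with ⟨e, m⟩ = 0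 and real numbers γ_1, …, γ_n such that for every k ∈ [n], every pair of disjoint sets I, J with I ⊔ J = [n]∖{k}, and every unit vector ν orthogonal to m and orthogonal to all differences of points of {p_i : i ∈ I} ∪ {q_j(0) : j ∈ J}, one has |⟨ν, e⟩| = γ_k (within Π, the hyperplanes of all facets of each P_(k) intersect one fixed hyperplane by the same angle). -/
open scoped RealInnerProductSpace BigOperators

/-- If, inside the hyperplane through `O` with normal `m`, every unit normal of `A` sees `O` at
height `r` above `A`, and `A` has codimension at least one there, then `r` is the distance
from `O` to the affine span of `A`. -/
theorem infDist_affineSpan_eq_of_unit_normals {E : Type*} [NormedAddCommGroup E]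
    [InnerProductSpace ℝ E] [FiniteDimensional ℝ E] {A : Set E} {a O m : E} {r : ℝ}
    (ha : a ∈ A) (hA : ∀ x ∈ A, ⟪x, m⟫ = ⟪O, m⟫)
    (hdim : Module.finrank ℝ (vectorSpan ℝ A) + 1 < Module.finrank ℝ E)
    (hr : ∀ ν : E, ‖ν‖ = 1 → ⟪ν, m⟫ = 0 → (∀ x ∈ A, ∀ y ∈ A, ⟪ν, x - y⟫ = 0) →
      |⟪ν, O - a⟫| = r) :
    Metric.infDist O (affineSpan ℝ A : Set E) = r := by
  have hle : vectorSpan ℝ A ≤ (ℝ ∙ m)ᗮ := by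
    rw [vectorSpan, Submodule.span_le]
    rintro _ ⟨x, hx, y, hy, rfl⟩
    rw [SetLike.mem_coe, Submodule.mem_orthogonal_singleton_iff_inner_left]
    simp [inner_sub_left, hA x hx, hA y hy]
  have hunit : ∀ v : E, v ≠ 0 → ⟪v, m⟫ = 0 → v ∈ (vectorSpan ℝ A)ᗮ →
      |⟪v, O - a⟫| = r * ‖v‖ := by
    intro v hv hvm hvA
    have hv' : ‖v‖ ≠ 0 := norm_ne_zero_iff.2 hv
    have := hr (‖v‖⁻¹ • v) (by simp [norm_smul, hv']) (by simp [inner_smul_left, hvm])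
      (fun x hx y hy => by
        rw [inner_smul_left, ← vsub_eq_sub,
          Submodule.inner_left_of_mem_orthogonal (vsub_mem_vectorSpan ℝ hx hy) hvA, mul_zero])
    rw [inner_smul_left, abs_mul] at this
    simp only [conj_trivial, abs_inv, abs_norm] at this
    rw [← this]
    field_simp
  have : Nonempty (affineSpan ℝ A) := ⟨⟨a, subset_affineSpan ℝ A ha⟩⟩
  rw [← EuclideanGeometry.dist_orthogonalProjection_eq_infDist, dist_eq_norm]
  have hP := EuclideanGeometry.vsub_orthogonalProjection_mem_direction_orthogonal
    (affineSpan ℝ A) O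
  have hPa := AffineSubspace.vsub_mem_direction
    (EuclideanGeometry.orthogonalProjection_mem (s := affineSpan ℝ A) O)
    (subset_affineSpan ℝ A ha)
  generalize (EuclideanGeometry.orthogonalProjection (affineSpan ℝ A) O : E) = P at hP hPa ⊢
  rw [direction_affineSpan, vsub_eq_sub] at hP hPa
  have hPm := (Submodule.mem_orthogonal_singleton_iff_inner_left).1 (hle hPa)
  rw [inner_sub_left, hA a ha] at hPm
  by_cases hw : O - P = 0
  · obtain ⟨v, hv, hv0⟩ : ∃ v ∈ (vectorSpan ℝ A ⊔ ℝ ∙ m)ᗮ, v ≠ 0 := by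
      refine Submodule.exists_mem_ne_zero_of_ne_bot fun hbot => ?_
      rw [Submodule.orthogonal_eq_bot_iff] at hbot
      have h1 := Submodule.finrank_add_le_finrank_add_finrank (vectorSpan ℝ A) (ℝ ∙ m)
      have h2 := finrank_span_le_card (R := ℝ) ({m} : Set E)
      rw [hbot, finrank_top] at h1
      simp only [Set.toFinset_singleton, Finset.card_singleton] at h2
      omega
    rw [← Submodule.inf_orthogonal] at hv
    have hvr := hunit v hv0 (Submodule.mem_orthogonal_singleton_iff_inner_left.1 hv.2) hv.1
    rw [sub_eq_zero.1 hw, Submodule.inner_left_of_mem_orthogonal hPa hv.1, abs_zero] at hvr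
    rw [hw, norm_zero]
    exact ((mul_eq_zero.1 hvr.symm).resolve_right (norm_ne_zero_iff.2 hv0)).symm
  · have hwr := hunit (O - P) hw (by rw [inner_sub_left]; linarith) hP
    rw [← sub_add_sub_cancel O P a, inner_add_right,
      Submodule.inner_left_of_mem_orthogonal hPa hP, add_zero, real_inner_self_eq_norm_sq,
      abs_of_nonneg (by positivity), sq] at hwr
    exact mul_right_cancel₀ (norm_ne_zero_iff.2 hw) hwr

/-- The points of an affine basis of a hyperplane with normal `m` span all directions
orthogonal to `m`. -/
theorem eq_zero_of_inner_sub_eq_zero {n : ℕ} {p : Fin n → EuclideanSpace ℝ (Fin n)}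
    {m : EuclideanSpace ℝ (Fin n)} {c : ℝ} (hn : n ≠ 0) (hp : AffineIndependent ℝ p) (hm : m ≠ 0)
    (hpm : ∀ j, ⟪p j, m⟫ = c) {v : EuclideanSpace ℝ (Fin n)} (hvm : ⟪v, m⟫ = 0)
    (hv : ∀ i j, ⟪v, p i - p j⟫ = 0) : v = 0 := by
  obtain ⟨d, rfl⟩ := Nat.exists_eq_succ_of_ne_zero hn
  have hle : vectorSpan ℝ (Set.range p) ≤ (ℝ ∙ m)ᗮ := by
    rw [vectorSpan, Submodule.span_le]
    rintro _ ⟨_, ⟨i, rfl⟩, _, ⟨j, rfl⟩, rfl⟩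
    rw [SetLike.mem_coe, Submodule.mem_orthogonal_singleton_iff_inner_left]
    simp [inner_sub_left, hpm]
  have : Fact (Module.finrank ℝ (EuclideanSpace ℝ (Fin (d + 1))) = d + 1) := ⟨by simp⟩
  have heq := Submodule.eq_of_le_of_finrank_eq hle (by
    rw [hp.finrank_vectorSpan (n := d) (by simp),
      Submodule.finrank_orthogonal_span_singleton (n := d) hm])
  have hvp : vectorSpan ℝ (Set.range p) ≤ (ℝ ∙ v)ᗮ := by
    rw [vectorSpan, Submodule.span_le]
    rintro _ ⟨_, ⟨i, rfl⟩, _, ⟨j, rfl⟩, rfl⟩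
    rw [SetLike.mem_coe, Submodule.mem_orthogonal_singleton_iff_inner_right]
    exact hv i j
  rw [heq] at hvp
  exact inner_self_eq_zero.1 (Submodule.mem_orthogonal_singleton_iff_inner_right.1
    (hvp (Submodule.mem_orthogonal_singleton_iff_inner_left.2 hvm)))

/-- A quadratic form depends only on the symmetric part of its matrix. -/
theorem sum_sum_mul_symm_part {ι : Type*} [Fintype ι] (M N : ι → ι → ℝ) (y : ι → ℝ)
    (hMN : ∀ i j, M i j + M j i = 2 * N i j) :
    ∑ i, ∑ j, y i * y j * N i j = ∑ i, y i * ∑ j, M i j * y j := by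
  have hswap : ∑ i, ∑ j, y i * y j * M j i = ∑ i, ∑ j, y i * y j * M i j := by
    rw [Finset.sum_comm]
    exact Finset.sum_congr rfl fun i _ => Finset.sum_congr rfl fun j _ => by ring
  have h2 : 2 * ∑ i, ∑ j, y i * y j * N i j
      = ∑ i, ∑ j, y i * y j * M i j + ∑ i, ∑ j, y i * y j * M j i := by
    simp only [Finset.mul_sum, ← Finset.sum_add_distrib]
    exact Finset.sum_congr rfl fun i _ => Finset.sum_congr rfl fun j _ => by
      linear_combination (-(y i * y j)) * hMN i j
  rw [hswap] at h2
  have h3 : ∑ i, y i * ∑ j, M i j * y j = ∑ i, ∑ j, y i * y j * M i j := by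
    simp only [Finset.mul_sum]
    exact Finset.sum_congr rfl fun i _ => Finset.sum_congr rfl fun j _ => by ring
  linarith

/-- If `x i * (H x) i` vanishes for all `i ≠ k`, the quadratic form of `g` at `x` is
`λ k ^ 2 * (∑ x i / λ i) ^ 2`. -/
theorem sum_sum_mul_eq_sq_sum_div {ι : Type*} [Fintype ι] (g h : ι → ι → ℝ) (lam x : ι → ℝ)
    (hlam : ∀ i, lam i ≠ 0) (hg : ∀ i j, h i j + h j i = 2 * g i j)
    (hh : ∀ i j, h i j * lam j / lam i + h j i * lam i / lam j = 2) (k : ι)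
    (hx : ∀ i, i ≠ k → x i * ∑ j, h i j * x j = 0) :
    ∑ i, ∑ j, x i * x j * g i j = lam k ^ 2 * (∑ i, x i / lam i) ^ 2 := by
  have h1 := sum_sum_mul_symm_part h g x hg
  have h2 := sum_sum_mul_symm_part (fun i j => h i j * lam j / lam i) (fun _ _ => 1)
    (fun i => x i / lam i) (fun i j => by rw [hh i j]; norm_num)
  rw [Finset.sum_eq_single k (fun i _ hi => hx i hi) (by simp)] at h1
  have h3 : ∀ i, x i / lam i * ∑ j, h i j * lam j / lam i * (x j / lam j)
      = (x i * ∑ j, h i j * x j) / lam i ^ 2 := by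
    intro i
    rw [Finset.mul_sum, Finset.mul_sum, Finset.sum_div]
    refine Finset.sum_congr rfl fun j _ => ?_
    have := hlam i
    have := hlam j
    field_simp
  simp only [h3, mul_one] at h2
  have h4 : ∑ i, (x i * ∑ j, h i j * x j) / lam i ^ 2 = (x k * ∑ j, h k j * x j) / lam k ^ 2 :=
    Finset.sum_eq_single k (fun i _ hi => by rw [hx i hi, zero_div]) (by simp)
  rw [← Finset.sum_mul_sum, h4] at h2
  have := hlam k
  rw [h1, sq (∑ i, x i / lam i), h2]
  field_simp

theorem sub_sq_ne_zero_of_ne_of_ne_neg {a b : ℝ} (h : a ≠ b ∧ a ≠ -b) : a ^ 2 - b ^ 2 ≠ 0 := by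
  rw [sub_ne_zero]
  exact fun hab => (sq_eq_sq_iff_eq_or_eq_neg.1 hab).elim h.1 h.2

/-- Vectors orthogonal to `m` expand in the facet normals of a simplex, with coefficients the
values at the vertices divided by the heights. -/
theorem eq_sum_inner_div_smul {n : ℕ} {p nv : Fin n → EuclideanSpace ℝ (Fin n)}
    {m : EuclideanSpace ℝ (Fin n)} {c : ℝ} {α b : Fin n → ℝ} (hn : n ≠ 0)
    (hp : AffineIndependent ℝ p) (hm : m ≠ 0) (hpm : ∀ j, ⟪p j, m⟫ = c)
    (hm_orth : ∀ i, ⟪m, nv i⟫ = 0) (hα : ∀ i, α i ≠ 0)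
    (hb : ∀ i j, ⟪nv i, p j⟫ = b i + if j = i then α i else 0)
    {v : EuclideanSpace ℝ (Fin n)} (hvm : ⟪v, m⟫ = 0) (s : ℝ) :
    v = ∑ l, ((⟪v, p l⟫ - s) / α l) • nv l := by
  refine sub_eq_zero.1 (eq_zero_of_inner_sub_eq_zero hn hp hm hpm ?_ fun i j => ?_)
  · simp [inner_sub_left, sum_inner, inner_smul_left, hvm, real_inner_comm, hm_orth]
  · have key : ∀ i j, ∑ l, (⟪v, p l⟫ - s) / α l * (⟪nv l, p i⟫ - ⟪nv l, p j⟫)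
        = ⟪v, p i⟫ - ⟪v, p j⟫ := by
      intro i j
      simp [hb, mul_sub, Finset.sum_sub_distrib, hα]
    rw [inner_sub_left, sum_inner, inner_sub_right]
    simp only [inner_smul_left, inner_sub_right, conj_trivial, ← mul_sub]
    rw [key, sub_self]

/-- in the flat position `u = 0` of a flexible cross-polytope of the
simplest type in Euclidean space, the `(n-1)`-dimensional cross-polytopes `P₍ₖ₎`
obtained by deleting the `k`-th pair of opposite vertices are either all circumscribed
about concentric spheres, or the hyperplanes of all facets of each `P₍ₖ₎` intersect one
fixed hyperplane by the same angle. -/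
theorem flat_position_circumscribed (n : ℕ) (hn : 3 ≤ n)
    (nv : Fin n → EuclideanSpace ℝ (Fin n))
    (m : EuclideanSpace ℝ (Fin n))
    (hnv_unit : ∀ i, ‖nv i‖ = 1)
    (hm_unit : ‖m‖ = 1)
    (hm_orth : ∀ i, ⟪m, nv i⟫ = 0)
    (lam : Fin n → ℝ)
    (hlam_ne : ∀ i, lam i ≠ 0)
    (hlam : ∀ i j : Fin n, i ≠ j → lam i ≠ lam j ∧ lam i ≠ -lam j)
    (h : Fin n → Fin n → ℝ)
    (hhdiag : ∀ i, h i i = 1)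
    (hhoff : ∀ i j : Fin n, i ≠ j →
      h i j = 2 * lam i * (lam i * ⟪nv i, nv j⟫ - lam j) / ((lam i) ^ 2 - (lam j) ^ 2))
    (p : Fin n → EuclideanSpace ℝ (Fin n))
    (hp_indep : AffineIndependent ℝ p)
    (cconst : ℝ)
    (hpm : ∀ j, ⟪p j, m⟫ = cconst)
    (hpn : ∀ i j k : Fin n, j ≠ i → k ≠ i → ⟪nv i, p j⟫ = ⟪nv i, p k⟫)
    (α : Fin n → ℝ)
    (hα : ∀ i j : Fin n, j ≠ i → α i = ⟪nv i, p i⟫ - ⟪nv i, p j⟫)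
    (hα_ne : ∀ i, α i ≠ 0)
    (hsum_ne : ∀ i, (∑ j, h i j / α j) ≠ 0)
    (β : Fin n → ℝ)
    (hβ : ∀ i, β i = (∑ j, h i j / α j)⁻¹)
    (q : Fin n → ℝ → EuclideanSpace ℝ (Fin n))
    (hq : ∀ (i : Fin n) (u : ℝ), q i u = β i • ((∑ j, (h i j / α j) • p j)
      - ((2 * (lam i) ^ 2 * u ^ 2) / ((lam i) ^ 2 * u ^ 2 + 1)) • nv i
      + ((2 * lam i * u) / ((lam i) ^ 2 * u ^ 2 + 1)) • m))
    (hlam_pos : ∀ i, 0 < lam i)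
    (hlam_mono : StrictMono lam)
    (hindep : ∀ A : Finset (Fin n),
      AffineIndependent ℝ (fun i : Fin n => if i ∈ A then p i else q i 0)) :
    -- (i) the cross-polytopes P₍ₖ₎ are circumscribed about concentric spheres
    (∃ O : EuclideanSpace ℝ (Fin n), ⟪O, m⟫ = cconst ∧
      ∃ r : Fin n → ℝ, (∀ k, 0 ≤ r k) ∧
        ∀ k : Fin n, ∀ I J : Finset (Fin n), Disjoint I J → I ∪ J = Finset.univ.erase k →
          Metric.infDist O
            (affineSpan ℝ (p '' ↑I ∪ (fun j => q j 0) '' ↑J) : Set (EuclideanSpace ℝ (Fin n)))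
            = r k) ∨
    -- (ii) the hyperplanes of all facets of each P₍ₖ₎ intersect a fixed hyperplane by
    -- the same angle
    (∃ e : EuclideanSpace ℝ (Fin n), ‖e‖ = 1 ∧ ⟪e, m⟫ = 0 ∧
      ∃ γ : Fin n → ℝ,
        ∀ k : Fin n, ∀ I J : Finset (Fin n), Disjoint I J → I ∪ J = Finset.univ.erase k →
          ∀ ν : EuclideanSpace ℝ (Fin n), ‖ν‖ = 1 → ⟪ν, m⟫ = 0 →
            (∀ x ∈ p '' ↑I ∪ (fun j => q j 0) '' ↑J,
             ∀ y ∈ p '' ↑I ∪ (fun j => q j 0) '' ↑J, ⟪ν, x - y⟫ = 0) →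
            |⟪ν, e⟫| = γ k) := by
  have hn0 : n ≠ 0 := by omega
  have hm0 : m ≠ 0 := norm_ne_zero_iff.1 (by rw [hm_unit]; exact one_ne_zero)
  have : Nontrivial (Fin n) := Fin.nontrivial_iff_two_le.2 (by omega)
  obtain ⟨b, hb⟩ : ∃ b : Fin n → ℝ, ∀ i j, ⟪nv i, p j⟫ = b i + if j = i then α i else 0 := by
    choose o ho using fun i : Fin n => exists_ne i
    refine ⟨fun i => ⟪nv i, p (o i)⟫, fun i j => ?_⟩
    split_ifs with hij
    · rw [hij, hα i (o i) (ho i)]; ring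
    · rw [add_zero, hpn i j (o i) hij (ho i)]
  have hg : ∀ i j, h i j + h j i = 2 * ⟪nv i, nv j⟫ := by
    intro i j
    rcases eq_or_ne i j with rfl | hij
    · rw [hhdiag, real_inner_self_eq_norm_sq, hnv_unit]; norm_num
    · have h1 := sub_sq_ne_zero_of_ne_of_ne_neg (hlam i j hij)
      rw [hhoff i j hij, hhoff j i hij.symm, real_inner_comm (nv i) (nv j),
        ← neg_sub (lam i ^ 2) (lam j ^ 2)]
      field_simp
      ring
  have hh : ∀ i j, h i j * lam j / lam i + h j i * lam i / lam j = 2 := by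
    intro i j
    have hi := hlam_ne i
    have hj := hlam_ne j
    rcases eq_or_ne i j with rfl | hij
    · rw [hhdiag]; field_simp; norm_num
    · have h1 := sub_sq_ne_zero_of_ne_of_ne_neg (hlam i j hij)
      rw [hhoff i j hij, hhoff j i hij.symm, real_inner_comm (nv i) (nv j),
        ← neg_sub (lam i ^ 2) (lam j ^ 2)]
      field_simp
      ring
  have hq0 : ∀ (ν : EuclideanSpace ℝ (Fin n)) (i : Fin n),
      ⟪ν, q i 0⟫ = β i * ∑ j, h i j / α j * ⟪ν, p j⟫ := by
    intro ν i
    simp [hq, inner_smul_right, inner_sum]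
  set S : ℝ := ∑ j, (lam j * α j)⁻¹ with hS
  set W : EuclideanSpace ℝ (Fin n) := ∑ j, (lam j * α j)⁻¹ • p j with hW
  have hnW : ∀ i, ⟪nv i, W⟫ = b i * S + (lam i)⁻¹ := by
    intro i
    have := hα_ne i
    simp only [hW, inner_sum, inner_smul_right, hb, mul_add, Finset.sum_add_distrib, hS,
      Finset.mul_sum, mul_ite, mul_zero, Finset.sum_ite_eq', Finset.mem_univ, if_true, mul_inv]
    congr 1
    · exact Finset.sum_congr rfl fun j _ => by ring
    · field_simp
  have hWm : ⟪W, m⟫ = S * cconst := by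
    simp [hW, hS, sum_inner, inner_smul_left, hpm, Finset.sum_mul]
  have key : ∀ k : Fin n, ∀ I J : Finset (Fin n), I ∪ J = Finset.univ.erase k →
      ∀ (ν : EuclideanSpace ℝ (Fin n)) (s : ℝ), ‖ν‖ = 1 → ⟪ν, m⟫ = 0 →
        (∀ x ∈ p '' ↑I ∪ (fun j => q j 0) '' ↑J, ⟪ν, x⟫ = s) →
        |⟪ν, W⟫ - s * S| = (lam k)⁻¹ := by
    intro k I J hIJ ν s hν hνm hs
    set x : Fin n → ℝ := fun l => (⟪ν, p l⟫ - s) / α l with hx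
    have hexp : ν = ∑ l, x l • nv l :=
      eq_sum_inner_div_smul hn0 hp_indep hm0 hpm hm_orth hα_ne hb hνm s
    have hx0 : ∀ i, i ≠ k → x i * ∑ j, h i j * x j = 0 := by
      intro i hi
      have hmem : i ∈ I ∪ J := by simp [hIJ, hi]
      rcases Finset.mem_union.1 hmem with hI | hJ
      · simp [hx, hs (p i) (Or.inl ⟨i, hI, rfl⟩)]
      · have h1 := hs (q i 0) (Or.inr ⟨i, hJ, rfl⟩)
        rw [hq0, hβ, inv_mul_eq_iff_eq_mul₀ (hsum_ne i), Finset.sum_mul] at h1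
        rw [mul_eq_zero]
        right
        rw [← sub_eq_zero.2 h1, ← Finset.sum_sub_distrib]
        exact Finset.sum_congr rfl fun j _ => by simp only [hx]; ring
    have hquad := sum_sum_mul_eq_sq_sum_div (fun i j => ⟪nv i, nv j⟫) h lam x hlam_ne hg hh k hx0
    have hnorm : ∑ i, ∑ j, x i * x j * ⟪nv i, nv j⟫ = 1 := by
      have hνν : ⟪∑ l, x l • nv l, ∑ l, x l • nv l⟫ = 1 := by
        rw [← hexp, real_inner_self_eq_norm_sq, hν, one_pow]
      rw [← hνν, sum_inner]
      refine Finset.sum_congr rfl fun i _ => ?_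
      rw [inner_sum]
      refine Finset.sum_congr rfl fun j _ => ?_
      rw [real_inner_smul_left, real_inner_smul_right, mul_assoc]
    have hval : ⟪ν, W⟫ - s * S = ∑ i, x i / lam i := by
      simp only [hW, hS, inner_sum, inner_smul_right, Finset.mul_sum, ← Finset.sum_sub_distrib]
      exact Finset.sum_congr rfl fun j _ => by simp only [hx, mul_inv]; ring
    rw [hnorm, ← mul_pow] at hquad
    have habs : |lam k * ∑ i, x i / lam i| = 1 := (pow_eq_one_iff_of_nonneg (abs_nonneg _)
      two_ne_zero).1 (by rw [sq_abs, hquad])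
    rw [abs_mul, abs_of_pos (hlam_pos k)] at habs
    rw [hval, eq_inv_of_mul_eq_one_right habs]
  have hne : ∀ k : Fin n, ∀ I J : Finset (Fin n), I ∪ J = Finset.univ.erase k →
      (p '' ↑I ∪ (fun j => q j 0) '' ↑J).Nonempty := by
    intro k I J hIJ
    obtain ⟨i, hi⟩ := exists_ne k
    have hmem : i ∈ I ∪ J := by simp [hIJ, hi]
    rcases Finset.mem_union.1 hmem with hI | hJ
    · exact ⟨p i, Or.inl ⟨i, hI, rfl⟩⟩
    · exact ⟨q i 0, Or.inr ⟨i, hJ, rfl⟩⟩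
  by_cases hS0 : S = 0
  · right
    have hW0 : W ≠ 0 := by
      intro hW0
      have := hnW ⟨0, by omega⟩
      rw [hW0, hS0, inner_zero_right, mul_zero, zero_add] at this
      exact inv_ne_zero (hlam_ne _) this.symm
    refine ⟨‖W‖⁻¹ • W, by simp [norm_smul, hW0], by simp [inner_smul_left, hWm, hS0],
      fun k => ‖W‖⁻¹ * (lam k)⁻¹, fun k I J _ hIJ ν hν hνm hdiff => ?_⟩
    obtain ⟨a, ha⟩ := hne k I J hIJ
    beta_reduce
    rw [← key k I J hIJ ν ⟪ν, a⟫ hν hνm fun x hx =>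
      sub_eq_zero.1 (by rw [← inner_sub_right, hdiff x hx a ha])]
    simp [inner_smul_right, abs_mul, hS0]
  · left
    refine ⟨S⁻¹ • W, by rw [inner_smul_left, hWm, conj_trivial, inv_mul_cancel_left₀ hS0],
      fun k => |S|⁻¹ * (lam k)⁻¹, fun k => by have := hlam_pos k; positivity,
      fun k I J hdisj hIJ => ?_⟩
    obtain ⟨a, ha⟩ := hne k I J hIJ
    refine infDist_affineSpan_eq_of_unit_normals (m := m) ha ?_ ?_ fun ν hν hνm hdiff => ?_
    · rw [inner_smul_left, hWm, conj_trivial, inv_mul_cancel_left₀ hS0]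
      rintro _ (⟨i, _, rfl⟩ | ⟨i, _, rfl⟩)
      · exact hpm i
      · rw [real_inner_comm, hq0]
        simp only [real_inner_comm _ m, hpm]
        rw [← Finset.sum_mul, hβ, inv_mul_cancel_left₀ (hsum_ne i)]
    · have himage : p '' ↑I ∪ (fun j => q j 0) '' ↑J
          = (fun i => if i ∈ I then p i else q i 0) '' ↑(Finset.univ.erase k) := by
        rw [← hIJ, Finset.coe_union, Set.image_union]
        refine congr_arg₂ _ (Set.image_congr fun i hi => ?_) (Set.image_congr fun i hi => ?_)
        · exact (if_pos hi).symm
        · exact (if_neg (Finset.disjoint_right.1 hdisj hi)).symm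
      have hcard : (Finset.univ.erase k).card = (n - 2) + 1 := by
        rw [Finset.card_erase_of_mem (Finset.mem_univ k), Finset.card_univ, Fintype.card_fin]
        omega
      have hrank := finrank_vectorSpan_image_finset_le ℝ
        (fun i => if i ∈ I then p i else q i 0) (Finset.univ.erase k) hcard
      rw [Finset.coe_image, ← himage] at hrank
      rw [finrank_euclideanSpace_fin]
      omega
    · beta_reduce
      rw [← key k I J hIJ ν ⟪ν, a⟫ hν hνm fun x hx =>
        sub_eq_zero.1 (by rw [← inner_sub_right, hdiff x hx a ha]), ← abs_inv, ← abs_mul,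
        inner_sub_right, inner_smul_right]
      congr 1
      field_simp
end
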